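/- arXiv:2503.19780 — 6 statements merged into one kernel-verified Lean document; each statement's English description precedes it below -/
import Mathlib

section
/- Let n ≥ 1 be an integer, T > 0, and let u, ω : ℝ × ℝ → ℝ be smooth. Define, for t ∈ [0,T) and nonzero x in EuclideanSpace ℝ (Fin n), the radial vector fields U(t,x) = (u(t,‖x‖)/‖x‖) • x and Ω(t,x) = (ω(t,‖x‖)/‖x‖) • x. Suppose that for all t ∈ [0,T) and all x ≠ 0 the EPDiff momentum equation holds: ∂_t Ω(t,x) + (D_x Ω(t,x))(U(t,x)) + (D_x U(t,x))*(Ω(t,x)) + (div U(t,x))·Ω(t,x) = 0, where D_x denotes the spatial Fréchet derivative, (·)* the adjoint of a linear map with respect to the Euclidean inner product, and div U the trace of D_x U. Then for all t ∈ [0,T) and all r > 0, the radial EPDiff equation holds: ∂_t ω(t,r) + u(t,r)·∂_r ω(t,r) + 2·∂_r u(t,r)·ω(t,r) + ((n−1)/r)·u(t,r)·ω(t,r) = 0. -/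
/-- The derivative at `x ≠ 0` of the radial vector field with radial component `f`. -/
theorem hasFDerivAt_radial_field {E : Type*} [NormedAddCommGroup E] [InnerProductSpace ℝ E]
    {f : ℝ → ℝ} {f' : ℝ} {V : E → E} {x : E} (hx : x ≠ 0) (hf : HasDerivAt f f' ‖x‖)
    (hV : ∀ y : E, y ≠ 0 → V y = (f ‖y‖ / ‖y‖) • y) :
    HasFDerivAt V ((f ‖x‖ / ‖x‖) • ContinuousLinearMap.id ℝ E
      + ((f' * ‖x‖ - f ‖x‖) / ‖x‖ ^ 3) • (innerSL ℝ x).smulRight x) x := by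
  have hr : ‖x‖ ≠ 0 := norm_ne_zero_iff.2 hx
  have hnorm : HasFDerivAt (fun y : E => ‖y‖) (‖x‖⁻¹ • innerSL ℝ x) x := by
    have h := (hasStrictFDerivAt_norm_sq x).hasFDerivAt.sqrt (pow_ne_zero 2 hr)
    simp only [Real.sqrt_sq (norm_nonneg _)] at h
    refine h.congr_fderiv ?_
    ext v
    simp only [smul_apply, smul_eq_mul, nsmul_eq_mul]
    field_simp
    simp
  have hq := (hf.div (hasDerivAt_id ‖x‖) hr).comp_hasFDerivAt x hnorm
  have h := hq.smul (hasFDerivAt_id x)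
  refine (h.congr_fderiv ?_).congr_of_eventuallyEq
    ((isOpen_ne.eventually_mem hx).mono fun y hy => hV y hy)
  ext v
  simp only [add_apply, smul_apply,
    ContinuousLinearMap.smulRight_apply, ContinuousLinearMap.id_apply, smul_smul, smul_eq_mul,
    Pi.div_apply, Function.comp_apply, id]
  congr 2
  field_simp

/-- The derivative at `x ≠ 0` of the radial vector field with radial component `f` has `x` as an
eigenvector, with eigenvalue the radial derivative of `f`. -/
theorem fderiv_radial_field_self {E : Type*} [NormedAddCommGroup E] [InnerProductSpace ℝ E]
    {f : ℝ → ℝ} {f' : ℝ} {V : E → E} {x : E} (hx : x ≠ 0) (hf : HasDerivAt f f' ‖x‖)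
    (hV : ∀ y : E, y ≠ 0 → V y = (f ‖y‖ / ‖y‖) • y) : fderiv ℝ V x x = f' • x := by
  have hr : ‖x‖ ≠ 0 := norm_ne_zero_iff.2 hx
  rw [(hasFDerivAt_radial_field hx hf hV).fderiv]
  simp only [add_apply, smul_apply,
    ContinuousLinearMap.smulRight_apply, ContinuousLinearMap.id_apply, smul_smul, ← add_smul,
    innerSL_apply_apply, real_inner_self_eq_norm_sq]
  congr 1
  field_simp
  ring

/-- The divergence at `x ≠ 0` of the radial vector field with radial component `f`. -/
theorem trace_fderiv_radial_field {E : Type*} [NormedAddCommGroup E] [InnerProductSpace ℝ E]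
    [FiniteDimensional ℝ E] {f : ℝ → ℝ} {f' : ℝ} {V : E → E} {x : E} (hx : x ≠ 0)
    (hf : HasDerivAt f f' ‖x‖) (hV : ∀ y : E, y ≠ 0 → V y = (f ‖y‖ / ‖y‖) • y) :
    LinearMap.trace ℝ E (fderiv ℝ V x).toLinearMap
      = f' + ((Module.finrank ℝ E : ℝ) - 1) / ‖x‖ * f ‖x‖ := by
  have hr : ‖x‖ ≠ 0 := norm_ne_zero_iff.2 hx
  have hL : ((innerSL ℝ x).smulRight x).toLinearMap
      = (innerSL ℝ x).toLinearMap.smulRight x := rfl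
  rw [(hasFDerivAt_radial_field hx hf hV).fderiv, ContinuousLinearMap.toLinearMap_add,
    ContinuousLinearMap.toLinearMap_smul, ContinuousLinearMap.toLinearMap_smul, hL, map_add,
    map_smul, map_smul, ContinuousLinearMap.coe_id, LinearMap.trace_id,
    LinearMap.trace_smulRight]
  simp only [ContinuousLinearMap.coe_coe, innerSL_apply_apply, real_inner_self_eq_norm_sq,
    smul_eq_mul]
  field_simp
  ring


/-- If the radial vector fields `U(t,x) = (u(t,‖x‖)/‖x‖) • x` and
`Ω(t,x) = (ω(t,‖x‖)/‖x‖) • x` satisfy the EPDiff momentum equation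
`∂ₜΩ + (DΩ)U + (DU)*Ω + (div U)·Ω = 0` for all `t ∈ [0,T)` and `x ≠ 0`, then the radial
components satisfy the radial EPDiff equation
`∂ₜω + u ∂ᵣω + 2(∂ᵣu)ω + ((n-1)/r) u ω = 0` for all `t ∈ [0,T)`, `r > 0`. -/
theorem radial_EPDiff_of_EPDiff
    (n : ℕ) (hn : 1 ≤ n) (T : ℝ) (hT : 0 < T)
    (u ω : ℝ × ℝ → ℝ) (hu : ContDiff ℝ (⊤ : ℕ∞) u) (hω : ContDiff ℝ (⊤ : ℕ∞) ω)
    (U Ω : ℝ → EuclideanSpace ℝ (Fin n) → EuclideanSpace ℝ (Fin n))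
    (hU : ∀ t, ∀ x : EuclideanSpace ℝ (Fin n), x ≠ 0 → U t x = (u (t, ‖x‖) / ‖x‖) • x)
    (hΩ : ∀ t, ∀ x : EuclideanSpace ℝ (Fin n), x ≠ 0 → Ω t x = (ω (t, ‖x‖) / ‖x‖) • x)
    (hEPDiff : ∀ t ∈ Set.Ico 0 T, ∀ x : EuclideanSpace ℝ (Fin n), x ≠ 0 →
      deriv (fun τ => Ω τ x) t
        + fderiv ℝ (Ω t) x (U t x)
        + ContinuousLinearMap.adjoint (fderiv ℝ (U t) x) (Ω t x)
        + (LinearMap.trace ℝ (EuclideanSpace ℝ (Fin n)) (fderiv ℝ (U t) x).toLinearMap)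
            • Ω t x = 0) :
    ∀ t ∈ Set.Ico 0 T, ∀ r : ℝ, 0 < r →
      deriv (fun τ => ω (τ, r)) t
        + u (t, r) * deriv (fun s => ω (t, s)) r
        + 2 * deriv (fun s => u (t, s)) r * ω (t, r)
        + (((n : ℝ) - 1) / r) * u (t, r) * ω (t, r) = 0 := by
  intro t ht r hr
  have hr0 : r ≠ 0 := hr.ne'
  set x : EuclideanSpace ℝ (Fin n) := EuclideanSpace.single ⟨0, hn⟩ r with hxdef
  have hxr : ‖x‖ = r := by simp [hxdef, abs_of_pos hr]
  have hx : x ≠ 0 := norm_ne_zero_iff.1 (hxr ▸ hr0)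
  have hud : HasDerivAt (fun s => u (t, s)) (deriv (fun s => u (t, s)) r) ‖x‖ := by
    rw [hxr]
    have := hu.differentiable (by simp)
    exact DifferentiableAt.hasDerivAt (by fun_prop)
  have hωd : HasDerivAt (fun s => ω (t, s)) (deriv (fun s => ω (t, s)) r) ‖x‖ := by
    rw [hxr]
    have := hω.differentiable (by simp)
    exact DifferentiableAt.hasDerivAt (by fun_prop)
  have hωt : HasDerivAt (fun τ => ω (τ, r)) (deriv (fun τ => ω (τ, r)) t) t := by
    have := hω.differentiable (by simp)
    exact DifferentiableAt.hasDerivAt (by fun_prop)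
  have htime : deriv (fun τ => Ω τ x) t = (deriv (fun τ => ω (τ, r)) t / r) • x := by
    have hfun : (fun τ => Ω τ x) = fun τ => (ω (τ, r) / r) • x := by
      funext τ
      rw [hΩ τ x hx, hxr]
    rw [hfun]
    exact ((hωt.div_const r).smul_const x).deriv
  have h := congrArg (fun v => inner ℝ v x) (hEPDiff t ht x hx)
  simp only [inner_add_left, inner_zero_left, ContinuousLinearMap.adjoint_inner_left] at h
  rw [htime, trace_fderiv_radial_field hx hud (hU t), hU t x hx, hΩ t x hx, map_smul,
    fderiv_radial_field_self hx hud (hU t), fderiv_radial_field_self hx hωd (hΩ t)] at h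
  simp only [real_inner_smul_left, real_inner_smul_right, real_inner_self_eq_norm_sq, hxr,
    finrank_euclideanSpace_fin] at h
  field_simp at h ⊢
  linear_combination h
end

section
/- Let n ≥ 1 be an integer and T > 0. Let u, ω : ℝ × ℝ → ℝ be continuously differentiable on [0,T) × (0,∞) and satisfy the radial EPDiff equation ∂_tω(t,r) + u(t,r)∂_rω(t,r) + 2∂_ru(t,r)·ω(t,r) + ((n−1)/r)u(t,r)ω(t,r) = 0 for all t ∈ [0,T) and r > 0. Let γ : ℝ × ℝ → ℝ be twice continuously differentiable on [0,T) × (0,∞) with γ(t,r) > 0, γ(0,r) = r, and ∂_t γ(t,r) = u(t, γ(t,r)) for all t ∈ [0,T), r > 0. Then for all t ∈ [0,T) and r > 0 the conservation law γ(t,r)^{n−1} · (∂_r γ(t,r))² · ω(t, γ(t,r)) = r^{n−1} · ω(0,r) holds. -/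
open Set Filter Topology

section Slices

variable {E : Type*} [NormedAddCommGroup E] [NormedSpace ℝ E] {f : ℝ × ℝ → E} {t r : ℝ}

theorem HasFDerivAt.hasDerivAt_slice_fst {f' : ℝ × ℝ →L[ℝ] E} (hf : HasFDerivAt f f' (t, r)) :
    HasDerivAt (fun τ => f (τ, r)) (f' (1, 0)) t :=
  hf.comp_hasDerivAt t ((hasDerivAt_id t).prodMk (hasDerivAt_const t r))

theorem HasFDerivAt.hasDerivAt_slice_snd {f' : ℝ × ℝ →L[ℝ] E} (hf : HasFDerivAt f f' (t, r)) :
    HasDerivAt (fun s => f (t, s)) (f' (0, 1)) r :=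
  hf.comp_hasDerivAt r ((hasDerivAt_const r t).prodMk (hasDerivAt_id r))

/-- A slice through an open factor of a product set is differentiated by the derivative within
that set. -/
theorem HasFDerivWithinAt.hasDerivAt_slice_snd {f' : ℝ × ℝ →L[ℝ] E} {A B : Set ℝ}
    (hf : HasFDerivWithinAt f f' (A ×ˢ B) (t, r)) (ht : t ∈ A) (hB : B ∈ 𝓝 r) :
    HasDerivAt (fun s => f (t, s)) (f' (0, 1)) r :=
  (hf.comp_hasDerivWithinAt (s := B) r
    ((hasDerivAt_const r t).prodMk (hasDerivAt_id r)).hasDerivWithinAt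
    fun _ hs => ⟨ht, hs⟩).hasDerivAt hB

/-- Mixed partial derivatives of a `C²` function commute: if the derivative of `f` in its first
variable at `(t, s)` is `g s` for `s` near `r`, then the derivative of `f` in its second variable
at `(τ, r)` has derivative `g'` in `τ` at `t`, where `g'` is the derivative of `g` at `r`. -/
theorem ContDiffAt.hasDerivAt_deriv_slice_snd {g : ℝ → E} {g' : E}
    (hf : ContDiffAt ℝ 2 f (t, r))
    (hg : ∀ᶠ s in 𝓝 r, deriv (fun τ => f (τ, s)) t = g s) (hg' : HasDerivAt g g' r) :
    HasDerivAt (fun τ => deriv (fun s => f (τ, s)) r) g' t := by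
  have hdiff : ∀ᶠ p in 𝓝 (t, r), HasFDerivAt f (fderiv ℝ f p) p :=
    (hf.eventually (by simp)).mono fun p hp => (hp.differentiableAt (by simp)).hasFDerivAt
  have hsecond : HasFDerivAt (fderiv ℝ f) (fderiv ℝ (fderiv ℝ f) (t, r)) (t, r) :=
    ((hf.fderiv_right (m := 1) (by norm_num)).differentiableAt (by simp)).hasFDerivAt
  have hsymm : fderiv ℝ (fderiv ℝ f) (t, r) (1, 0) (0, 1)
      = fderiv ℝ (fderiv ℝ f) (t, r) (0, 1) (1, 0) :=
    (hf.isSymmSndFDerivAt (by simp)) (1, 0) (0, 1)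
  have htime : HasDerivAt (fun τ => fderiv ℝ f (τ, r) (0, 1))
      (fderiv ℝ (fderiv ℝ f) (t, r) (1, 0) (0, 1)) t := by
    simpa using hsecond.hasDerivAt_slice_fst.clm_apply (hasDerivAt_const t ((0, 1) : ℝ × ℝ))
  have hspace : HasDerivAt (fun s => fderiv ℝ f (t, s) (1, 0))
      (fderiv ℝ (fderiv ℝ f) (t, r) (0, 1) (1, 0)) r := by
    simpa using hsecond.hasDerivAt_slice_snd.clm_apply (hasDerivAt_const r ((1, 0) : ℝ × ℝ))
  have hdiff_space : ∀ᶠ s in 𝓝 r, fderiv ℝ f (t, s) (1, 0) = g s := by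
    have hcont : Tendsto (fun s : ℝ => (t, s)) (𝓝 r) (𝓝 (t, r)) :=
      (Continuous.prodMk_right t).tendsto r
    filter_upwards [hcont.eventually hdiff, hg] with s hs hgs
    rw [← hgs, hs.hasDerivAt_slice_fst.deriv]
  have hdiff_time : ∀ᶠ τ in 𝓝 t, deriv (fun s => f (τ, s)) r = fderiv ℝ f (τ, r) (0, 1) := by
    have hcont : Tendsto (fun τ : ℝ => (τ, r)) (𝓝 t) (𝓝 (t, r)) :=
      (Continuous.prodMk_left r).tendsto t
    filter_upwards [hcont.eventually hdiff] with τ hτ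
    exact hτ.hasDerivAt_slice_snd.deriv
  have hvalue := hspace.unique (hg'.congr_of_eventuallyEq hdiff_space)
  rw [← hvalue, ← hsymm]
  exact htime.congr_of_eventuallyEq hdiff_time

end Slices

/-- Conservation law for the radial EPDiff equation: if `u, ω` are `C¹` on
`[0,T) × (0,∞)` and satisfy the radial EPDiff equation, and `γ` is a `C²` positive Lagrangian
flow of `u` with `γ(0,r) = r`, then
`γ(t,r)^{n-1} (∂ᵣγ(t,r))² ω(t,γ(t,r)) = r^{n-1} ω(0,r)` for all `t ∈ [0,T)`, `r > 0`. -/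
theorem radial_EPDiff_conservation_law
    (n : ℕ) (hn : 1 ≤ n) (T : ℝ) (hT : 0 < T)
    (u ω : ℝ × ℝ → ℝ)
    (hu : ContDiffOn ℝ 1 u (Set.Ico 0 T ×ˢ Set.Ioi (0:ℝ)))
    (hω : ContDiffOn ℝ 1 ω (Set.Ico 0 T ×ˢ Set.Ioi (0:ℝ)))
    (hEPDiff : ∀ t ∈ Set.Ico 0 T, ∀ r : ℝ, 0 < r →
      deriv (fun τ => ω (τ, r)) t
        + u (t, r) * deriv (fun s => ω (t, s)) r
        + 2 * deriv (fun s => u (t, s)) r * ω (t, r)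
        + (((n : ℝ) - 1) / r) * u (t, r) * ω (t, r) = 0)
    (γ : ℝ × ℝ → ℝ)
    (hγ : ContDiffOn ℝ 2 γ (Set.Ico 0 T ×ˢ Set.Ioi (0:ℝ)))
    (hγpos : ∀ t ∈ Set.Ico 0 T, ∀ r : ℝ, 0 < r → 0 < γ (t, r))
    (hγ0 : ∀ r : ℝ, 0 < r → γ (0, r) = r)
    (hflow : ∀ t ∈ Set.Ico 0 T, ∀ r : ℝ, 0 < r →
      deriv (fun τ => γ (τ, r)) t = u (t, γ (t, r))) :
    ∀ t ∈ Set.Ico 0 T, ∀ r : ℝ, 0 < r →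
      γ (t, r) ^ (n - 1) * (deriv (fun s => γ (t, s)) r) ^ 2 * ω (t, γ (t, r))
        = r ^ (n - 1) * ω (0, r) := by
  intro t ht r hr
  obtain ⟨m, rfl⟩ : ∃ m, n = m + 1 := ⟨n - 1, by omega⟩
  rw [Nat.add_sub_cancel]
  set S : Set (ℝ × ℝ) := Ico 0 T ×ˢ Ioi (0 : ℝ) with hS
  set F : ℝ → ℝ := fun τ => γ (τ, r) ^ m * (deriv (fun s => γ (τ, s)) r) ^ 2 * ω (τ, γ (τ, r))
    with hF
  have hderiv : ∀ τ ∈ Ico 0 T, deriv (fun s => γ (τ, s)) r = fderivWithin ℝ γ S (τ, r) (0, 1) :=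
    fun τ hτ => (((hγ.differentiableOn (by simp)) (τ, r) ⟨hτ, hr⟩).hasFDerivWithinAt
      |>.hasDerivAt_slice_snd hτ (Ioi_mem_nhds hr)).deriv
  have hmaps : MapsTo (fun τ : ℝ => (τ, r)) (Ico 0 T) S := fun τ hτ => ⟨hτ, hr⟩
  have hslice : ContinuousOn (fun τ : ℝ => (τ, r)) (Ico 0 T) :=
    (Continuous.prodMk_left r).continuousOn
  have hγcont : ContinuousOn (fun τ => γ (τ, r)) (Ico 0 T) := hγ.continuousOn.comp hslice hmaps
  have hFcont : ContinuousOn F (Ico 0 T) := by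
    refine ((hγcont.pow m).mul (ContinuousOn.pow ?_ 2)).mul
      (hω.continuousOn.comp (continuousOn_id.prodMk hγcont) fun τ hτ => ⟨hτ, hγpos τ hτ r hr⟩)
    refine ContinuousOn.congr ?_ hderiv
    exact ((hγ.continuousOn_fderivWithin
      ((uniqueDiffOn_Ico 0 T).prod (uniqueDiffOn_Ioi 0)) (by norm_num)).comp hslice
        hmaps).clm_apply continuousOn_const
  have hFderiv : ∀ τ ∈ Ioo 0 T, HasDerivAt F 0 τ := by
    intro τ hτ
    have hτ' : τ ∈ Ico 0 T := ⟨hτ.1.le, hτ.2⟩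
    have hnhds : ∀ s : ℝ, 0 < s → S ∈ 𝓝 (τ, s) := fun s hs =>
      prod_mem_nhds (Ico_mem_nhds hτ.1 hτ.2) (Ioi_mem_nhds hs)
    have hρ := hγpos τ hτ' r hr
    have hudiff := ((hu.contDiffAt (hnhds _ hρ)).differentiableAt (by simp)).hasFDerivAt
    have hωdiff := ((hω.contDiffAt (hnhds _ hρ)).differentiableAt (by simp)).hasFDerivAt
    have hγC2 := hγ.contDiffAt (hnhds r hr)
    have hγdiff := (hγC2.differentiableAt (by simp)).hasFDerivAt
    have hγt : HasDerivAt (fun σ => γ (σ, r)) (u (τ, γ (τ, r))) τ := by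
      rw [← hflow τ hτ' r hr]
      exact hγdiff.hasDerivAt_slice_fst.differentiableAt.hasDerivAt
    have hγr := hγdiff.hasDerivAt_slice_snd.differentiableAt.hasDerivAt
    have hur := hudiff.hasDerivAt_slice_snd.differentiableAt.hasDerivAt
    have hγrt := hγC2.hasDerivAt_deriv_slice_snd
      (by filter_upwards [Ioi_mem_nhds hr] with s hs using hflow τ hτ' s hs)
      (hur.comp r hγr)
    have hωt : HasDerivAt (fun σ => ω (σ, γ (σ, r)))
        (deriv (fun σ => ω (σ, γ (τ, r))) τ
          + u (τ, γ (τ, r)) * deriv (fun s => ω (τ, s)) (γ (τ, r))) τ := by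
      have h := hωdiff.comp_hasDerivAt τ ((hasDerivAt_id τ).prodMk hγt)
      have hsplit : ((1, u (τ, γ (τ, r))) : ℝ × ℝ)
          = (1, 0) + u (τ, γ (τ, r)) • ((0, 1) : ℝ × ℝ) := by simp
      rw [hsplit, map_add, map_smul, smul_eq_mul] at h
      rw [hωdiff.hasDerivAt_slice_fst.deriv, hωdiff.hasDerivAt_slice_snd.deriv]
      exact h
    have hpde := hEPDiff τ hτ' _ hρ
    have hpow : (m : ℝ) * γ (τ, r) ^ (m - 1) = γ (τ, r) ^ m * (m / γ (τ, r)) := by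
      cases m with
      | zero => simp
      | succ k =>
        rw [Nat.add_sub_cancel, pow_succ]
        field_simp
    refine (((hγt.pow m).mul (hγrt.pow 2)).mul hωt).congr_deriv ?_
    push_cast at hpde
    simp only [Pi.mul_apply, Pi.pow_apply, hpow]
    linear_combination γ (τ, r) ^ m * (deriv (fun s => γ (τ, s)) r) ^ 2 * hpde
  have hF0 : F 0 = r ^ m * ω (0, r) := by
    have h1 : deriv (fun s => γ (0, s)) r = 1 := by
      have : (fun s => γ (0, s)) =ᶠ[𝓝 r] id := by
        filter_upwards [Ioi_mem_nhds hr] with s hs using hγ0 s hs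
      rw [this.deriv_eq, deriv_id]
    simp only [hF, h1, hγ0 r hr, one_pow, mul_one]
  rw [← hF0]
  rcases ht.1.eq_or_lt with rfl | hpos
  · rfl
  · obtain ⟨c, -, hc⟩ := exists_hasDerivAt_eq_slope F (fun _ => 0) hpos
      (hFcont.mono (Icc_subset_Ico_right ht.2))
      fun τ hτ => hFderiv τ ⟨hτ.1, hτ.2.trans ht.2⟩
    rcases div_eq_zero_iff.mp hc.symm with h | h
    · exact sub_eq_zero.mp h
    · linarith
end

section
/- Let a, b, c ∈ ℝ with c > 0 and let z ∈ (0,1). Then the function w ↦ w^c · F(a,b;c+1;w) (real power w^c) has derivative at z equal to c · z^{c−1} · F(a,b;c;z). -/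
/-- The rising factorial (Pochhammer symbol) `(x)_j = x(x+1)⋯(x+j-1)`. -/
noncomputable def risingFactorial (j : ℕ) (x : ℝ) : ℝ := (ascPochhammer ℝ j).eval x

/-- The Gauss hypergeometric function `F(a,b;c;z) = ∑_{j=0}^∞ ((a)_j (b)_j/((c)_j j!)) z^j`. -/
noncomputable def hypF (a b c z : ℝ) : ℝ :=
  ∑' j : ℕ, risingFactorial j a * risingFactorial j b
    / (risingFactorial j c * (Nat.factorial j : ℝ)) * z ^ j

open Filter Topology in
/-- The hypergeometric series converges absolutely inside the unit disc. -/
theorem summable_hypF_abs (a b c r : ℝ) (hc : 0 < c) (hr : |r| < 1) :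
    Summable fun j : ℕ => |risingFactorial j a * risingFactorial j b
      / (risingFactorial j c * (Nat.factorial j : ℝ)) * r ^ j| := by
  obtain ⟨s, hrs, hs⟩ := exists_between hr
  have hlim : Tendsto (fun j : ℕ => |(a + j) / (c + j) * ((b + j) / (1 + j)) * r|) atTop
      (𝓝 |r|) := by
    have h (x y : ℝ) : Tendsto (fun j : ℕ => (x + j) / (y + j)) atTop (𝓝 1) := by
      simpa using tendsto_add_mul_div_add_mul_atTop_nhds x y 1 (one_ne_zero (α := ℝ))
    simpa using (((h a c).mul (h b 1)).mul_const r).abs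
  refine summable_of_ratio_norm_eventually_le hs ?_
  filter_upwards [hlim.eventually_le_const hrs] with j hj
  have hpos : 0 < risingFactorial j c := ascPochhammer_pos j c hc
  have hfac : (0 : ℝ) < Nat.factorial j := by positivity
  have hcj : 0 < c + j := by positivity
  have hj1 : (0 : ℝ) < 1 + j := by positivity
  have hsucc (x : ℝ) : risingFactorial (j + 1) x = risingFactorial j x * (x + j) :=
    ascPochhammer_succ_eval j x
  rw [Real.norm_eq_abs, Real.norm_eq_abs, abs_abs, abs_abs]
  calc _ = |(a + j) / (c + j) * ((b + j) / (1 + j)) * r| *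
        |risingFactorial j a * risingFactorial j b
          / (risingFactorial j c * (Nat.factorial j : ℝ)) * r ^ j| := by
        rw [← abs_mul]
        congr 1
        rw [hsucc, hsucc, hsucc, Nat.factorial_succ]
        push_cast
        rw [add_comm (j : ℝ) 1]
        field_simp
        ring
    _ ≤ _ := by gcongr

theorem risingFactorial_add_one_mul (c : ℝ) (j : ℕ) :
    c * risingFactorial j (c + 1) = risingFactorial j c * (c + j) := by
  have h := ascPochhammer_succ_eval j c
  rw [ascPochhammer_succ_left] at h
  simpa [risingFactorial, Polynomial.eval_comp] using h

/-- Raising the denominator parameter of the hypergeometric coefficients. -/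
theorem add_mul_hypF_coeff (a b c : ℝ) (hc : 0 < c) (j : ℕ) :
    (c + j) * (risingFactorial j a * risingFactorial j b
      / (risingFactorial j (c + 1) * (Nat.factorial j : ℝ))) =
    c * (risingFactorial j a * risingFactorial j b
      / (risingFactorial j c * (Nat.factorial j : ℝ))) := by
  have h0 : 0 < risingFactorial j c := ascPochhammer_pos j c hc
  have h1 : 0 < risingFactorial j (c + 1) := ascPochhammer_pos j (c + 1) (by positivity)
  have hfac : (0 : ℝ) < Nat.factorial j := by positivity
  field_simp
  linear_combination
    (-(risingFactorial j a * risingFactorial j b)) * risingFactorial_add_one_mul c j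

/-- Derivative formula `(d/dz)[z^c F(a,b;c+1;z)] = c z^{c-1} F(a,b;c;z)`
for `c > 0` and `z ∈ (0,1)`, with real powers. -/
theorem hypergeometric_weighted_deriv_c
    (a b c : ℝ) (hc : 0 < c) (z : ℝ) (hz : z ∈ Set.Ioo (0:ℝ) 1) :
    HasDerivAt (fun w : ℝ => w ^ c * hypF a b (c + 1) w)
      (c * z ^ (c - 1) * hypF a b c z) z := by
  obtain ⟨hz0, hz1⟩ := hz
  obtain ⟨r, hzr, hr1⟩ := exists_between hz1
  have hr0 : 0 < r := hz0.trans hzr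
  have hcoeff := add_mul_hypF_coeff a b c hc
  have hsum := summable_hypF_abs a b c r hc (by rwa [abs_of_pos hr0])
  have hsum_z := (summable_hypF_abs a b (c + 1) z (by positivity)
    (by rwa [abs_of_pos hz0])).of_abs
  unfold hypF
  set d : ℕ → ℝ := fun j => risingFactorial j a * risingFactorial j b
    / (risingFactorial j (c + 1) * (Nat.factorial j : ℝ))
  set e : ℕ → ℝ := fun j => risingFactorial j a * risingFactorial j b
    / (risingFactorial j c * (Nat.factorial j : ℝ))
  change ∀ j : ℕ, (c + j) * d j = c * e j at hcoeff
  change Summable fun j => |e j * r ^ j| at hsum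
  change Summable fun j => d j * z ^ j at hsum_z
  change HasDerivAt (fun w : ℝ => w ^ c * ∑' j, d j * w ^ j)
    (c * z ^ (c - 1) * ∑' j, e j * z ^ j) z
  have hbound (j : ℕ) (y : ℝ) (hy : y ∈ Set.Ioo 0 r) :
      ‖d j * (j * y ^ (j - 1))‖ ≤ c / r * |e j * r ^ j| := by
    obtain _ | j := j
    · simp only [Nat.cast_zero, zero_mul, mul_zero, norm_zero]
      positivity
    · have hc' := congrArg abs (hcoeff (j + 1))
      rw [abs_mul, abs_mul, abs_of_pos hc, abs_of_pos (by positivity)] at hc'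
      have hy0 := hy.1
      have hyr : y ^ j ≤ r ^ j := pow_le_pow_left₀ hy0.le hy.2.le j
      have hle : ((j + 1 : ℕ) : ℝ) * |d (j + 1)| ≤ c * |e (j + 1)| := by
        rw [← hc']
        gcongr
        linarith
      rw [Real.norm_eq_abs, abs_mul, abs_mul, Nat.abs_cast, Nat.add_sub_cancel, abs_mul,
        abs_of_pos (pow_pos hy0 j), abs_of_pos (pow_pos hr0 (j + 1))]
      calc |d (j + 1)| * (((j + 1 : ℕ) : ℝ) * y ^ j)
          = (((j + 1 : ℕ) : ℝ) * |d (j + 1)|) * y ^ j := by ring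
        _ ≤ (c * |e (j + 1)|) * r ^ j := by gcongr
        _ = _ := by
          field_simp
          ring
  have hzmem : z ∈ Set.Ioo 0 r := ⟨hz0, hzr⟩
  have hderiv : HasDerivAt (fun w : ℝ => ∑' j, d j * w ^ j)
      (∑' j, d j * (j * z ^ (j - 1))) z :=
    hasDerivAt_tsum_of_isPreconnected (hsum.mul_left (c / r)) isOpen_Ioo isPreconnected_Ioo
      (fun j y _ => (hasDerivAt_pow j y).const_mul (d j)) hbound hzmem hsum_z hzmem
  have hsum_d : Summable fun j : ℕ => d j * (j * z ^ (j - 1)) :=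
    .of_norm_bounded (hsum.mul_left (c / r)) fun j => hbound j z hzmem
  have hrel : c * ∑' j, e j * z ^ j =
      c * (∑' j, d j * z ^ j) + z * ∑' j, d j * (j * z ^ (j - 1)) := by
    rw [← tsum_mul_left, ← tsum_mul_left, ← tsum_mul_left,
      ← (hsum_z.mul_left c).tsum_add (hsum_d.mul_left z)]
    refine tsum_congr fun j => ?_
    rw [← mul_assoc, ← hcoeff]
    obtain _ | j := j
    · simp
    · rw [Nat.add_sub_cancel]
      ring
  convert! (Real.hasDerivAt_rpow_const (p := c) (Or.inl hz0.ne')).mul hderiv using 1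
  have hpow : z ^ c = z ^ (c - 1) * z := by
    rw [← Real.rpow_add_one hz0.ne', sub_add_cancel]
  rw [hpow]
  linear_combination z ^ (c - 1) * hrel
end

section
/- Let a, b, c ∈ ℝ with c > 0 and let z ∈ (0,1). Then the function w ↦ w^{a−1} · F(a−1,b;c;w) (real power w^{a−1}) has derivative at z equal to (a−1) · z^{a−2} · F(a,b;c;z). -/
open Filter Topology in
/-- The series obtained from the Gauss series by multiplying its `n`-th term by `n` converges
absolutely on `(0, 1)`. -/
theorem summable_natCast_mul_hypF_term (a b c : ℝ) (hc : 0 < c) {r : ℝ}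
    (hr : r ∈ Set.Ioo (0 : ℝ) 1) :
    Summable fun n : ℕ => (n : ℝ) * (risingFactorial n a * risingFactorial n b
      / (risingFactorial n c * (Nat.factorial n : ℝ)) * r ^ n) := by
  obtain ⟨q, hrq, hq⟩ := exists_between hr.2
  have hlim : Tendsto (fun n : ℕ => |(a + 1 * n) / (0 + 1 * n) * ((b + 1 * n) / (c + 1 * n)) * r|)
      atTop (𝓝 |(1 : ℝ) / 1 * (1 / 1) * r|) :=
    (((tendsto_add_mul_div_add_mul_atTop_nhds a 0 1 one_ne_zero).mul
      (tendsto_add_mul_div_add_mul_atTop_nhds b c 1 one_ne_zero)).mul_const r).abs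
  have hlt : |(1 : ℝ) / 1 * (1 / 1) * r| < q := by
    simpa [abs_of_pos hr.1] using hrq
  refine summable_of_ratio_norm_eventually_le hq ?_
  filter_upwards [hlim.eventually_lt_const hlt, eventually_ge_atTop 1] with n hn hn1
  have hn0 : (n : ℝ) ≠ 0 := by positivity
  have hcn : c + n ≠ 0 := by positivity
  have hpc : (ascPochhammer ℝ n).eval c ≠ 0 := (ascPochhammer_pos n c hc).ne'
  rw [← Real.norm_eq_abs] at hn
  refine le_trans (le_of_eq ?_) (mul_le_mul_of_nonneg_right hn.le (norm_nonneg _))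
  rw [← norm_mul]
  congr 1
  simp only [risingFactorial, ascPochhammer_succ_eval, Nat.factorial_succ, Nat.cast_mul,
    Nat.cast_succ, one_mul, zero_add, pow_succ]
  have : (n : ℝ) + 1 ≠ 0 := by positivity
  field_simp

/-- The Gauss series converges on `(0, 1)`. -/
theorem summable_hypF_term (a b c : ℝ) (hc : 0 < c) {r : ℝ} (hr : r ∈ Set.Ioo (0 : ℝ) 1) :
    Summable fun n : ℕ => risingFactorial n a * risingFactorial n b
      / (risingFactorial n c * (Nat.factorial n : ℝ)) * r ^ n := by
  refine (summable_natCast_mul_hypF_term a b c hc hr).norm.of_norm_bounded_eventually_nat ?_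
  filter_upwards [Filter.eventually_ge_atTop 1] with n hn
  rw [norm_mul (n : ℝ), Real.norm_natCast]
  exact le_mul_of_one_le_left (norm_nonneg _) (mod_cast hn)

/-- Termwise differentiation of the Gauss series on `(0, 1)`. -/
theorem hasDerivAt_hypF (a b c : ℝ) (hc : 0 < c) {z : ℝ} (hz : z ∈ Set.Ioo (0 : ℝ) 1) :
    HasDerivAt (hypF a b c)
      (∑' n : ℕ, risingFactorial n a * risingFactorial n b
        / (risingFactorial n c * (Nat.factorial n : ℝ)) * (n * z ^ (n - 1))) z := by
  obtain ⟨r, hzr, hr⟩ := exists_between hz.2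
  have hr0 : 0 < r := hz.1.trans hzr
  refine hasDerivAt_tsum_of_isPreconnected
    ((summable_natCast_mul_hypF_term a b c hc ⟨hr0, hr⟩).norm.mul_right r⁻¹)
    isOpen_Ioo isPreconnected_Ioo (t := Set.Ioo 0 r)
    (fun n y _ => (hasDerivAt_pow n y).const_mul _) (fun n y hy => ?_)
    (y₀ := z) ⟨hz.1, hzr⟩ (summable_hypF_term a b c hc hz) ⟨hz.1, hzr⟩
  rcases n with _ | n
  · simp
  · have hpow : ‖y ^ n‖ ≤ r ^ n := by
      rw [norm_pow, Real.norm_of_nonneg hy.1.le]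
      exact pow_le_pow_left₀ hy.1.le hy.2.le n
    simp only [norm_mul, norm_pow, Real.norm_of_nonneg hr0.le, Nat.add_sub_cancel, pow_succ r]
    rw [norm_pow] at hpow
    calc _ ≤ _ := mul_le_mul_of_nonneg_left
            (mul_le_mul_of_nonneg_left hpow (norm_nonneg ((n + 1 : ℕ) : ℝ))) (norm_nonneg _)
      _ = _ := by field_simp

/-- Shifting the argument of the rising factorial by one. -/
theorem add_mul_risingFactorial (x : ℝ) (n : ℕ) :
    (x + n) * risingFactorial n x = x * risingFactorial n (x + 1) := by
  rw [risingFactorial, risingFactorial, mul_comm, ← ascPochhammer_succ_eval,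
    ascPochhammer_succ_left]
  simp

/-- Derivative formula
`(d/dz)[z^{a-1} F(a-1,b;c;z)] = (a-1) z^{a-2} F(a,b;c;z)` for `c > 0` and `z ∈ (0,1)`,
with real powers. -/
theorem hypergeometric_weighted_deriv_a
    (a b c : ℝ) (hc : 0 < c) (z : ℝ) (hz : z ∈ Set.Ioo (0:ℝ) 1) :
    HasDerivAt (fun w : ℝ => w ^ (a - 1) * hypF (a - 1) b c w)
      ((a - 1) * z ^ (a - 2) * hypF a b c z) z := by
  have hz0 : z ≠ 0 := hz.1.ne'
  refine ((Real.hasDerivAt_rpow_const (p := a - 1) (Or.inl hz0)).mul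
    (hasDerivAt_hypF (a - 1) b c hc hz)).congr_deriv ?_
  have hexp : z ^ (a - 1) = z ^ (a - 2) * z := by
    rw [← Real.rpow_add_one hz0]
    ring_nf
  have hsum := (summable_hypF_term (a - 1) b c hc hz).mul_left (a - 1)
  have hsum' := summable_natCast_mul_hypF_term (a - 1) b c hc hz
  have hderiv : ∀ n : ℕ, z * ((n : ℝ) * z ^ (n - 1)) = n * z ^ n := by
    rintro (_ | n)
    · simp
    · simp only [Nat.add_sub_cancel, pow_succ]
      ring
  have key : (a - 1) * hypF (a - 1) b c z
      + z * ∑' n : ℕ, risingFactorial n (a - 1) * risingFactorial n b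
        / (risingFactorial n c * (Nat.factorial n : ℝ)) * (n * z ^ (n - 1))
      = (a - 1) * hypF a b c z := by
    simp only [hypF, ← tsum_mul_left]
    rw [← hsum.tsum_add (hsum'.congr fun n => ?_)]
    · refine tsum_congr fun n => ?_
      have h := add_mul_risingFactorial (a - 1) n
      rw [sub_add_cancel] at h
      linear_combination risingFactorial n b
        / (risingFactorial n c * (Nat.factorial n : ℝ)) * (z ^ n * h
          + risingFactorial n (a - 1) * hderiv n)
    · linear_combination -(risingFactorial n (a - 1) * risingFactorial n b
        / (risingFactorial n c * (Nat.factorial n : ℝ)) * hderiv n)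
  rw [show a - 1 - 1 = a - 2 by ring, hexp]
  linear_combination z ^ (a - 2) * key
end

section
/- Let a, b, c ∈ ℝ with c > b > 0 and c − a − b > 0. Then the series ∑_{j=0}^∞ (a)_j (b)_j / ((c)_j · j!) is summable, and its sum equals Γ(c)·Γ(c−a−b) / (Γ(c−a)·Γ(c−b)), where Γ is the real Gamma function. -/
open Filter Topology

lemma risingFactorial_succ (j : ℕ) (x : ℝ) :
    risingFactorial (j + 1) x = risingFactorial j x * (x + j) :=
  ascPochhammer_succ_eval j x

lemma risingFactorial_zero (x : ℝ) : risingFactorial 0 x = 1 := by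
  simp [risingFactorial]

lemma risingFactorial_pos {x : ℝ} (hx : 0 < x) (j : ℕ) : 0 < risingFactorial j x :=
  ascPochhammer_pos j x hx

lemma mul_risingFactorial_add_one (j : ℕ) (x : ℝ) :
    x * risingFactorial j (x + 1) = risingFactorial j x * (x + j) := by
  induction j with
  | zero => simp [risingFactorial_zero]
  | succ j ih =>
    rw [risingFactorial_succ, risingFactorial_succ, ← mul_assoc, ih]
    push_cast
    ring

/-- Raising the base from `c` to `x` multiplies the rising factorial by at least `x / c`. -/
lemma mul_risingFactorial_succ_le {c x : ℝ} (hc : 0 < c) (hx : c ≤ x) (j : ℕ) :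
    x * risingFactorial (j + 1) c ≤ c * risingFactorial (j + 1) x := by
  induction j with
  | zero => simp [risingFactorial_succ, risingFactorial_zero, mul_comm]
  | succ j ih =>
    rw [risingFactorial_succ (j + 1), risingFactorial_succ (j + 1), ← mul_assoc, ← mul_assoc]
    have := (risingFactorial_pos (hc.trans_le hx) (j + 1)).le
    gcongr

/-- The `j`-th term of the Gauss series at `z = 1`. -/
noncomputable def gaussTerm (a b c : ℝ) (j : ℕ) : ℝ :=
  risingFactorial j a * risingFactorial j b / (risingFactorial j c * (Nat.factorial j : ℝ))

lemma gaussTerm_zero (a b c : ℝ) : gaussTerm a b c 0 = 1 := by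
  simp [gaussTerm, risingFactorial_zero]

lemma gaussTerm_succ {a b c : ℝ} (hc : 0 < c) (j : ℕ) :
    (j + 1 : ℝ) * gaussTerm a b c (j + 1) = gaussTerm a b c j * ((a + j) * (b + j) / (c + j)) := by
  have h1 := (risingFactorial_pos hc j).ne'
  have h2 : c + j ≠ 0 := by positivity
  have h3 : (Nat.factorial j : ℝ) ≠ 0 := by positivity
  have h4 : (j + 1 : ℝ) ≠ 0 := by positivity
  simp only [gaussTerm, risingFactorial_succ, Nat.factorial_succ]
  push_cast
  field_simp

lemma gaussTerm_add_one {a b c : ℝ} (hc : 0 < c) (j : ℕ) :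
    gaussTerm a b (c + 1) j = gaussTerm a b c j * (c / (c + j)) := by
  have h1 := (risingFactorial_pos hc j).ne'
  have h2 : c + j ≠ 0 := by positivity
  have h3 : (Nat.factorial j : ℝ) ≠ 0 := by positivity
  have h : risingFactorial j (c + 1) = risingFactorial j c * (c + j) / c := by
    rw [eq_div_iff hc.ne', ← mul_risingFactorial_add_one, mul_comm]
  rw [gaussTerm, gaussTerm, h]
  field_simp

lemma abs_gaussTerm_succ_le {a b c x : ℝ} (hc : 0 < c) (hx : c ≤ x) (j : ℕ) :
    |gaussTerm a b x (j + 1)| ≤ c / x * |gaussTerm a b c (j + 1)| := by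
  have hx0 := hc.trans_le hx
  have h1 := risingFactorial_pos hc (j + 1)
  have h2 := risingFactorial_pos hx0 (j + 1)
  have h := mul_risingFactorial_succ_le hc hx j
  have hf : (0 : ℝ) < (Nat.factorial (j + 1) : ℝ) := by positivity
  simp only [gaussTerm, abs_div, abs_mul, abs_of_pos h1, abs_of_pos h2, abs_of_pos hf]
  rw [div_mul_div_comm, div_le_div_iff₀ (by positivity) (by positivity)]
  have := mul_le_mul_of_nonneg_left h (show 0 ≤ |risingFactorial (j + 1) a| *
    |risingFactorial (j + 1) b| * (Nat.factorial (j + 1) : ℝ) by positivity)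
  linarith

lemma gaussTerm_telescope {a b c : ℝ} (hc : 0 < c) (j : ℕ) :
    c * (c - a - b) * gaussTerm a b c j - (c - a) * (c - b) * gaussTerm a b (c + 1) j
      = c * (j * gaussTerm a b c j - (j + 1 : ℝ) * gaussTerm a b c (j + 1)) := by
  have h2 : c + j ≠ 0 := by positivity
  rw [gaussTerm_add_one hc, gaussTerm_succ hc]
  field_simp
  ring

/-- Eventually the weighted absolute terms decrease by a fixed fraction of the term. -/
lemma eventually_mul_abs_gaussTerm_le {a b c : ℝ} (hc : 0 < c) (h : 0 < c - a - b) :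
    ∀ᶠ j : ℕ in atTop, (c - a - b) / 2 * |gaussTerm a b c j| ≤
      j * |gaussTerm a b c j| - (j + 1 : ℝ) * |gaussTerm a b c (j + 1)| := by
  have hj := tendsto_natCast_atTop_atTop (R := ℝ)
  have hd := hj.const_mul_atTop (half_pos h)
  filter_upwards [hj.eventually_ge_atTop (-a), hj.eventually_ge_atTop (-b),
    hd.eventually_ge_atTop ((c - a - b) / 2 * c + a * b)] with j ha hb hd
  have hcj : 0 < c + j := by positivity
  have e : (j + 1 : ℝ) * |gaussTerm a b c (j + 1)|
      = |gaussTerm a b c j| * ((a + j) * (b + j) / (c + j)) := by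
    have := congrArg abs (gaussTerm_succ (a := a) (b := b) hc j)
    rwa [abs_mul, abs_mul, abs_of_nonneg (by positivity : (0 : ℝ) ≤ j + 1),
      abs_of_nonneg (div_nonneg (mul_nonneg (by linarith) (by linarith)) hcj.le)] at this
  have key : (c - a - b) / 2 ≤ j - (a + j) * (b + j) / (c + j) := by
    rw [le_sub_iff_add_le, ← le_sub_iff_add_le', div_le_iff₀ hcj]
    nlinarith
  rw [e]
  nlinarith [mul_le_mul_of_nonneg_right key (abs_nonneg (gaussTerm a b c j))]

lemma summable_abs_gaussTerm {a b c : ℝ} (hc : 0 < c) (h : 0 < c - a - b) :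
    Summable fun j => |gaussTerm a b c j| := by
  obtain ⟨N, hN⟩ := eventually_atTop.1 (eventually_mul_abs_gaussTerm_le hc h)
  rw [← summable_nat_add_iff N]
  refine summable_of_sum_range_le (c := N * |gaussTerm a b c N| / ((c - a - b) / 2))
    (fun _ => abs_nonneg _) fun n => ?_
  rw [le_div_iff₀ (half_pos h)]
  suffices H : (∑ i ∈ Finset.range n, |gaussTerm a b c (i + N)|) * ((c - a - b) / 2) ≤
      N * |gaussTerm a b c N| - (n + N : ℕ) * |gaussTerm a b c (n + N)| by
    have : 0 ≤ ((n + N : ℕ) : ℝ) * |gaussTerm a b c (n + N)| := by positivity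
    linarith
  induction n with
  | zero => simp
  | succ n ih =>
    have := hN (n + N) (by omega)
    rw [Finset.sum_range_succ, add_right_comm n 1 N]
    push_cast at *
    linarith

lemma summable_gaussTerm {a b c : ℝ} (hc : 0 < c) (h : 0 < c - a - b) :
    Summable (gaussTerm a b c) :=
  (summable_abs_gaussTerm hc h).of_abs

/-- A summable sequence `f` for which `n * f n` converges has `n * f n → 0`. -/
lemma eq_zero_of_tendsto_natCast_mul {f : ℕ → ℝ} {l : ℝ} (hf : Summable fun n => |f n|)
    (hl : Tendsto (fun n : ℕ => n * f n) atTop (𝓝 l)) : l = 0 := by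
  by_contra h
  have hpos : 0 < |l| / 2 := by positivity
  have hev := hl.abs.eventually_const_lt (half_lt_self (abs_pos.2 h))
  have : Summable fun n : ℕ => (1 : ℝ) / n := by
    refine Summable.of_norm_bounded_eventually_nat (hf.mul_left (|l| / 2)⁻¹) ?_
    filter_upwards [hev, eventually_gt_atTop 0] with n hn hn0
    have hn0' : (0 : ℝ) < n := by exact_mod_cast hn0
    rw [abs_mul, abs_of_pos hn0'] at hn
    rw [Real.norm_of_nonneg (by positivity), div_le_iff₀ hn0', mul_assoc,
      ← div_eq_inv_mul, le_div_iff₀ hpos]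
    linarith
  exact Real.not_summable_one_div_natCast this

lemma tsum_gaussTerm_recurrence {a b c : ℝ} (hc : 0 < c) (h : 0 < c - a - b) :
    c * (c - a - b) * ∑' j, gaussTerm a b c j
      = (c - a) * (c - b) * ∑' j, gaussTerm a b (c + 1) j := by
  have hs := (summable_gaussTerm hc h).hasSum.mul_left (c * (c - a - b))
  have hs' := (summable_gaussTerm (a := a) (b := b) (c := c + 1)
    (by linarith) (by linarith)).hasSum.mul_left ((c - a) * (c - b))
  have ht := (hs.sub hs').tendsto_sum_nat
  have hsum (n : ℕ) : ∑ j ∈ Finset.range n, (c * (c - a - b) * gaussTerm a b c j -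
      (c - a) * (c - b) * gaussTerm a b (c + 1) j) = -c * (n * gaussTerm a b c n) := by
    induction n with
    | zero => simp
    | succ n ih =>
      rw [Finset.sum_range_succ, ih, gaussTerm_telescope hc]
      push_cast
      ring
  simp only [hsum] at ht
  have ht' := ht.const_mul (-c)⁻¹
  simp only [inv_mul_cancel_left₀ (neg_ne_zero.2 hc.ne')] at ht'
  have := eq_zero_of_tendsto_natCast_mul (summable_abs_gaussTerm hc h) ht'
  rw [mul_eq_zero, or_iff_right (inv_ne_zero (neg_ne_zero.2 hc.ne'))] at this
  exact sub_eq_zero.1 this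

lemma tsum_gaussTerm_mul_prod {a b c : ℝ} (hc : 0 < c) (h : 0 < c - a - b) (n : ℕ) :
    ((∏ j ∈ Finset.range n, (c + j)) * ∏ j ∈ Finset.range n, (c - a - b + j)) *
        ∑' j, gaussTerm a b c j
      = ((∏ j ∈ Finset.range n, (c - a + j)) * ∏ j ∈ Finset.range n, (c - b + j)) *
        ∑' j, gaussTerm a b (c + n) j := by
  induction n with
  | zero => simp
  | succ n ih =>
    have hn : (0 : ℝ) ≤ n := by positivity
    have hr := tsum_gaussTerm_recurrence (a := a) (b := b) (c := c + n)
      (by linarith) (by linarith)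
    simp only [Finset.prod_range_succ]
    push_cast
    rw [← add_assoc]
    linear_combination (c + n) * (c - a - b + n) * ih +
      (∏ j ∈ Finset.range n, (c - a + j)) * (∏ j ∈ Finset.range n, (c - b + j)) * hr

lemma tendsto_tsum_gaussTerm_add_natCast {a b c : ℝ} (hc : 0 < c) (h : 0 < c - a - b) :
    Tendsto (fun n : ℕ => ∑' j, gaussTerm a b (c + n) j) atTop (𝓝 1) := by
  have hlim : Tendsto (fun n : ℕ => 1 + ∑' j, gaussTerm a b (c + n) (j + 1)) atTop (𝓝 (1 + 0)) := by
    refine tendsto_const_nhds.add (squeeze_zero_norm (a := fun n : ℕ =>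
      c / (c + n) * ∑' j, |gaussTerm a b c (j + 1)|) (fun n => ?_) ?_)
    · have hs := (summable_nat_add_iff 1).2 (summable_abs_gaussTerm hc h)
      exact tsum_of_norm_bounded (hs.hasSum.mul_left _) fun j =>
        abs_gaussTerm_succ_le hc (by simp) j
    · rw [← zero_mul (∑' j, |gaussTerm a b c (j + 1)|)]
      exact ((tendsto_atTop_add_const_left _ c tendsto_natCast_atTop_atTop).const_div_atTop
        c).mul_const _
  rw [add_zero] at hlim
  refine hlim.congr fun n => ?_
  have hn : (0 : ℝ) ≤ n := by positivity
  rw [(summable_gaussTerm (a := a) (b := b) (c := c + n)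
    (by linarith) (by linarith)).tsum_eq_zero_add, gaussTerm_zero]

lemma tsum_gaussTerm_mul_GammaSeq {a b c : ℝ} (hc : 0 < c) (hca : 0 < c - a) (hcb : 0 < c - b)
    (h : 0 < c - a - b) {n : ℕ} (hn : n ≠ 0) :
    (∑' j, gaussTerm a b c j) * (Real.GammaSeq (c - a) n * Real.GammaSeq (c - b) n)
      = Real.GammaSeq c n * Real.GammaSeq (c - a - b) n *
        ∑' j, gaussTerm a b (c + (n + 1 : ℕ)) j := by
  have key := tsum_gaussTerm_mul_prod hc h (n + 1)
  have hprod {x : ℝ} (hx : 0 < x) : ∏ j ∈ Finset.range (n + 1), (x + j) ≠ 0 :=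
    (Finset.prod_pos fun j _ => by positivity).ne'
  have h1 := hprod hc
  have h2 := hprod hca
  have h3 := hprod hcb
  have h4 := hprod h
  have hn0 : (0 : ℝ) < n := by positivity
  have hpow : (n : ℝ) ^ (c - a) * (n : ℝ) ^ (c - b) = (n : ℝ) ^ c * (n : ℝ) ^ (c - a - b) := by
    rw [← Real.rpow_add hn0, ← Real.rpow_add hn0]
    ring_nf
  simp only [Real.GammaSeq]
  rw [div_mul_div_comm, div_mul_div_comm, mul_div_assoc', div_mul_eq_mul_div,
    div_eq_div_iff (mul_ne_zero h2 h3) (mul_ne_zero h1 h4)]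
  linear_combination (∑' j, gaussTerm a b c j) * (∏ j ∈ Finset.range (n + 1), (c + j)) *
    (∏ j ∈ Finset.range (n + 1), (c - a - b + j)) * (n.factorial : ℝ) ^ 2 * hpow +
    (n : ℝ) ^ c * (n : ℝ) ^ (c - a - b) * (n.factorial : ℝ) ^ 2 * key


/-- Gauss's summation theorem: for `c > b > 0` and `c - a - b > 0`, the
series `∑_{j=0}^∞ (a)_j (b)_j/((c)_j j!)` is summable with sum
`Γ(c)Γ(c-a-b)/(Γ(c-a)Γ(c-b))`. -/
theorem gauss_summation
    (a b c : ℝ) (hb : 0 < b) (hcb : b < c) (hcab : 0 < c - a - b) :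
    Summable (fun j : ℕ => risingFactorial j a * risingFactorial j b
      / (risingFactorial j c * (Nat.factorial j : ℝ))) ∧
    (∑' j : ℕ, risingFactorial j a * risingFactorial j b
        / (risingFactorial j c * (Nat.factorial j : ℝ)))
      = Real.Gamma c * Real.Gamma (c - a - b)
        / (Real.Gamma (c - a) * Real.Gamma (c - b)) := by
  change Summable (gaussTerm a b c) ∧ ∑' j, gaussTerm a b c j = _
  have hc : 0 < c := hb.trans hcb
  have hca : 0 < c - a := by linarith
  have hcb' : 0 < c - b := sub_pos.2 hcb
  refine ⟨summable_gaussTerm hc hcab, ?_⟩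
  rw [eq_div_iff (mul_pos (Real.Gamma_pos_of_pos hca) (Real.Gamma_pos_of_pos hcb')).ne']
  have hl := ((Real.GammaSeq_tendsto_Gamma (c - a)).mul
    (Real.GammaSeq_tendsto_Gamma (c - b))).const_mul (∑' j, gaussTerm a b c j)
  have hr := ((Real.GammaSeq_tendsto_Gamma c).mul (Real.GammaSeq_tendsto_Gamma (c - a - b))).mul
    ((tendsto_add_atTop_iff_nat 1).2 (tendsto_tsum_gaussTerm_add_natCast hc hcab))
  rw [mul_one] at hr
  refine tendsto_nhds_unique hl (hr.congr' ?_)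
  filter_upwards [eventually_ne_atTop 0] with n hn
  exact (tsum_gaussTerm_mul_GammaSeq hc hca hcb' hcab hn).symm
end

section
/- Let n ≥ 1 be an integer and let ω : ℝ → ℝ be continuous with compact support contained in (0,∞). Define u : (0,∞) → ℝ by u(r) = (r^{1−n}/n)·∫_0^r s^n·ω(s) ds + (r/n)·∫_r^∞ ω(s) ds. Then u is twice differentiable on (0,∞) and for every r > 0: u''(r) + ((n−1)/r)·u'(r) − ((n−1)/r²)·u(r) = −ω(r). -/
open MeasureTheory

/-- The tail integral of an integrable continuous function has derivative `-f`. -/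
theorem hasDerivAt_integral_Ioi_of_continuous {f : ℝ → ℝ} (hf : Continuous f)
    (hfi : Integrable f) (x : ℝ) :
    HasDerivAt (fun r => ∫ s in Set.Ioi r, f s) (-f x) x := by
  have h : (fun r => ∫ s in Set.Ioi r, f s) =
      fun r => (∫ s in Set.Ioi 0, f s) - ∫ s in (0 : ℝ)..r, f s := by
    funext r
    rw [← intervalIntegral.integral_interval_add_Ioi (a := 0) (b := r)
      hfi.integrableOn hfi.integrableOn, add_sub_cancel_left]
  rw [h]
  exact (hf.integral_hasStrictDerivAt 0 x).hasDerivAt.const_sub _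

/-- For continuous `ω` with compact support in `(0,∞)`, the function
`u(r) = (r^{1-n}/n) ∫_0^r s^n ω(s) ds + (r/n) ∫_r^∞ ω(s) ds` is twice differentiable on
`(0,∞)` and satisfies `u'' + ((n-1)/r) u' - ((n-1)/r²) u = -ω` there, i.e. the `k = 1`
kernel formula inverts `-Δ` on radial vector fields. -/
theorem green_function_laplacian
    (n : ℕ) (hn : 1 ≤ n) (ω : ℝ → ℝ)
    (hω : Continuous ω) (hωsupp : HasCompactSupport ω) (hωpos : tsupport ω ⊆ Set.Ioi 0)
    (u : ℝ → ℝ)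
    (hu : ∀ r : ℝ, 0 < r →
      u r = (r ^ ((1 : ℤ) - n) / n) * (∫ s in (0:ℝ)..r, s ^ n * ω s)
            + (r / n) * ∫ s in Set.Ioi r, ω s) :
    ∀ r : ℝ, 0 < r →
      (DifferentiableAt ℝ u r ∧ DifferentiableAt ℝ (deriv u) r) ∧
      deriv (deriv u) r + (((n : ℝ) - 1) / r) * deriv u r
        - (((n : ℝ) - 1) / r ^ 2) * u r = -ω r := by
  have hn0 : (n : ℝ) ≠ 0 := by positivity
  have hB := hasDerivAt_integral_Ioi_of_continuous hω (hω.integrable_of_hasCompactSupport hωsupp)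
  have hA : ∀ r : ℝ, HasDerivAt (fun r => ∫ s in (0 : ℝ)..r, s ^ n * ω s) (r ^ n * ω r) r :=
    fun r => (((continuous_id.pow n).mul hω).integral_hasStrictDerivAt 0 r).hasDerivAt
  set A : ℝ → ℝ := fun r => ∫ s in (0 : ℝ)..r, s ^ n * ω s
  set B : ℝ → ℝ := fun r => ∫ s in Set.Ioi r, ω s
  have hu' : ∀ r : ℝ, 0 < r →
      HasDerivAt u ((1 - n) / n * r ^ (-(n : ℤ)) * A r + B r / n) r := by
    intro r hr
    have hr0 := hr.ne'
    have h := (((hasDerivAt_zpow ((1 : ℤ) - n) r (Or.inl hr0)).div_const (n : ℝ)).mul (hA r)).add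
      (((hasDerivAt_id r).div_const (n : ℝ)).mul (hB r))
    refine (h.congr_of_eventuallyEq ?_).congr_deriv ?_
    · filter_upwards [lt_mem_nhds hr] with x hx using hu x hx
    · rw [show (1 : ℤ) - n - 1 = -(n : ℤ) by ring, zpow_sub₀ hr0, zpow_neg]
      simp only [zpow_one, zpow_natCast, id]
      push_cast
      field_simp
      ring
  have hu'' : ∀ r : ℝ, 0 < r →
      HasDerivAt (deriv u) ((n - 1) * r ^ (-(n : ℤ) - 1) * A r - ω r) r := by
    intro r hr
    have hr0 := hr.ne'
    have h := (((hasDerivAt_zpow (-(n : ℤ)) r (Or.inl hr0)).const_mul ((1 - n) / n : ℝ)).mul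
      (hA r)).add ((hB r).div_const (n : ℝ))
    refine (h.congr_of_eventuallyEq ?_).congr_deriv ?_
    · filter_upwards [lt_mem_nhds hr] with x hx using (hu' x hx).deriv
    · rw [zpow_sub₀ hr0, zpow_neg]
      simp only [zpow_one, zpow_natCast]
      push_cast
      field_simp
      ring
  intro r hr
  have hr0 := hr.ne'
  refine ⟨⟨(hu' r hr).differentiableAt, (hu'' r hr).differentiableAt⟩, ?_⟩
  rw [(hu'' r hr).deriv, (hu' r hr).deriv, show u r = r ^ ((1 : ℤ) - n) / n * A r + r / n * B r
    from hu r hr, zpow_sub₀ hr0, zpow_sub₀ hr0, zpow_neg]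
  simp only [zpow_one, zpow_natCast]
  field_simp
  ring
end
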